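/- The three bone boundary words in the letters X, Y, Z evaluate to the identity matrix: B₁ = Z·Z·Z·Y·z·z·X = I, B₂ = Z·x·x·Y·X·X·X = I, and B₃ = Z·Y·Y·Y·X·y·y = I. -/

import Mathlib

open Matrix

/-- `ω = exp(2πi/12)`, a primitive 12th root of unity. -/
noncomputable def ω : ℂ := Complex.exp (2 * Real.pi * Complex.I / 12)

/-- The SL₂(ℂ) connection matrix on northeast edges. -/
noncomputable def α : Matrix (Fin 2) (Fin 2) ℂ := !![ω^7, 0; 0, ω^5]

/-- The SL₂(ℂ) connection matrix on northwest edges. -/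
noncomputable def β : Matrix (Fin 2) (Fin 2) ℂ := !![ω^7, ω^3; 0, ω^5]

/-- The SL₂(ℂ) connection matrix on horizontal edges. -/
noncomputable def γ : Matrix (Fin 2) (Fin 2) ℂ := !![ω^5, 0; ω^3, ω^7]

/-- The length-two move `X = β·α`. -/
noncomputable def X : Matrix (Fin 2) (Fin 2) ℂ := β * α

/-- The length-two move `Y = α⁻¹·γ`. -/
noncomputable def Y : Matrix (Fin 2) (Fin 2) ℂ := α⁻¹ * γ

/-- The length-two move `Z = γ⁻¹·β⁻¹`. -/
noncomputable def Z : Matrix (Fin 2) (Fin 2) ℂ := γ⁻¹ * β⁻¹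

/-- `x = X⁻¹`. -/
noncomputable def x : Matrix (Fin 2) (Fin 2) ℂ := X⁻¹

/-- `y = Y⁻¹`. -/
noncomputable def y : Matrix (Fin 2) (Fin 2) ℂ := Y⁻¹

/-- `z = Z⁻¹`. -/
noncomputable def z : Matrix (Fin 2) (Fin 2) ℂ := Z⁻¹

theorem isPrimitiveRoot_ω : IsPrimitiveRoot ω 12 := by
  simpa [ω] using Complex.isPrimitiveRoot_exp 12 (by norm_num)

/-- `ω` is a root of the twelfth cyclotomic polynomial. -/
theorem ω_pow_four : ω ^ 4 = ω ^ 2 - 1 := by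
  have h12 : ω ^ 12 = 1 := isPrimitiveRoot_ω.pow_eq_one
  have h6 : ω ^ 6 - 1 ≠ 0 :=
    sub_ne_zero.2 (isPrimitiveRoot_ω.pow_ne_one_of_pos_of_lt (by norm_num) (by norm_num))
  have h4 : ω ^ 2 + 1 ≠ 0 := fun h =>
    isPrimitiveRoot_ω.pow_ne_one_of_pos_of_lt (l := 4) (by norm_num) (by norm_num)
      (by linear_combination (ω ^ 2 - 1) * h)
  have h : (ω ^ 6 - 1) * ((ω ^ 2 + 1) * (ω ^ 4 - ω ^ 2 + 1)) = 0 := by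
    linear_combination h12
  have h' := (mul_eq_zero.1 ((mul_eq_zero.1 h).resolve_left h6)).resolve_left h4
  linear_combination h'

theorem α_inv : α⁻¹ = !![ω ^ 5, 0; 0, ω ^ 7] := by
  apply Matrix.inv_eq_right_inv
  ext i j
  fin_cases i <;> fin_cases j <;> simp [α] <;> grind [ω_pow_four]

theorem β_inv : β⁻¹ = !![ω ^ 5, -ω ^ 3; 0, ω ^ 7] := by
  apply Matrix.inv_eq_right_inv
  ext i j
  fin_cases i <;> fin_cases j <;> simp [β] <;> grind [ω_pow_four]

theorem γ_inv : γ⁻¹ = !![ω ^ 7, 0; -ω ^ 3, ω ^ 5] := by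
  apply Matrix.inv_eq_right_inv
  ext i j
  fin_cases i <;> fin_cases j <;> simp [γ] <;> grind [ω_pow_four]

theorem X_eq : X = !![ω ^ 2, -ω ^ 2; 0, 1 - ω ^ 2] := by
  ext i j
  fin_cases i <;> fin_cases j <;> simp [X, α, β] <;> grind [ω_pow_four]

theorem Y_eq : Y = !![1 - ω ^ 2, 0; 1 - ω ^ 2, ω ^ 2] := by
  ext i j
  fin_cases i <;> fin_cases j <;> simp [Y, α_inv, γ] <;> grind [ω_pow_four]

theorem Z_eq : Z = !![1, ω ^ 2 - 1; ω ^ 2, 0] := by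
  ext i j
  fin_cases i <;> fin_cases j <;> simp [Z, β_inv, γ_inv] <;> grind [ω_pow_four]

theorem x_eq : x = !![1 - ω ^ 2, ω ^ 2; 0, ω ^ 2] := by
  apply Matrix.inv_eq_right_inv
  ext i j
  fin_cases i <;> fin_cases j <;> simp [X_eq] <;> grind [ω_pow_four]

theorem y_eq : y = !![ω ^ 2, 0; ω ^ 2 - 1, 1 - ω ^ 2] := by
  apply Matrix.inv_eq_right_inv
  ext i j
  fin_cases i <;> fin_cases j <;> simp [Y_eq] <;> grind [ω_pow_four]

theorem z_eq : z = !![0, 1 - ω ^ 2; -ω ^ 2, 1] := by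
  apply Matrix.inv_eq_right_inv
  ext i j
  fin_cases i <;> fin_cases j <;> simp [Z_eq] <;> grind [ω_pow_four]

/-- The three bone boundary words in the letters X, Y, Z evaluate to the identity matrix. -/
theorem bone_words_XYZ_eq_one :
    Z * Z * Z * Y * z * z * X = (1 : Matrix (Fin 2) (Fin 2) ℂ) ∧
    Z * x * x * Y * X * X * X = (1 : Matrix (Fin 2) (Fin 2) ℂ) ∧
    Z * Y * Y * Y * X * y * y = (1 : Matrix (Fin 2) (Fin 2) ℂ) := by
  rw [X_eq, Y_eq, Z_eq, x_eq, y_eq, z_eq]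
  refine ⟨?_, ?_, ?_⟩ <;> ext i j <;> fin_cases i <;> fin_cases j <;> simp <;>
    grind [ω_pow_four]
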